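/- Fix q ∈ (0, 2]. There exists a constant c_q ≤ 4 such that for all t ≥ √2 and all real μ, the hard thresholding risk satisfies E|X·1{|X| ≥ t} − μ|^q ≤ c_q (|μ|^q + t^{q−1} φ(t)), where X ~ N(μ, 1). -/

import Mathlib

open Real MeasureTheory ProbabilityTheory

noncomputable def stdNormalPDF : ℝ → ℝ :=
  fun x => (Real.sqrt (2 * Real.pi))⁻¹ * Real.exp (-x ^ 2 / 2)

noncomputable def hardThresh (x t : ℝ) : ℝ := if t ≤ |x| then x else 0

open Set Filter Topology

lemma stdNormalPDF_eq_gaussianPDFReal (x : ℝ) : stdNormalPDF x = gaussianPDFReal 0 1 x := by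
  simp [stdNormalPDF, gaussianPDFReal]

lemma stdNormalPDF_pos (x : ℝ) : 0 < stdNormalPDF x := by
  unfold stdNormalPDF
  positivity

lemma stdNormalPDF_neg (x : ℝ) : stdNormalPDF (-x) = stdNormalPDF x := by
  simp [stdNormalPDF]

lemma hasDerivAt_stdNormalPDF (x : ℝ) : HasDerivAt stdNormalPDF (-(x * stdNormalPDF x)) x := by
  have h : HasDerivAt (fun x : ℝ => -x ^ 2 / 2) (-x) x := by
    refine ((hasDerivAt_pow 2 x).fun_neg.div_const 2).congr_deriv ?_
    push_cast
    ring
  refine (h.exp.const_mul (Real.sqrt (2 * Real.pi))⁻¹).congr_deriv ?_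
  simp only [stdNormalPDF]
  ring

lemma continuous_stdNormalPDF : Continuous stdNormalPDF := by
  unfold stdNormalPDF
  fun_prop

lemma integrable_stdNormalPDF : Integrable stdNormalPDF := by
  rw [funext stdNormalPDF_eq_gaussianPDFReal]
  exact integrable_gaussianPDFReal 0 1

lemma integral_stdNormalPDF : ∫ x, stdNormalPDF x = 1 := by
  rw [funext stdNormalPDF_eq_gaussianPDFReal]
  exact integral_gaussianPDFReal_eq_one 0 one_ne_zero

lemma stdNormalPDF_mul_le (x : ℝ) :
    stdNormalPDF x * (1 + x ^ 2 / 2 + x ^ 4 / 8) ≤ 2 / 5 := by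
  have hpi : (Real.sqrt (2 * Real.pi))⁻¹ ≤ 2 / 5 := by
    have : (5 / 2 : ℝ) ≤ Real.sqrt (2 * Real.pi) := by
      apply Real.le_sqrt_of_sq_le
      linarith [Real.pi_gt_d2]
    calc (Real.sqrt (2 * Real.pi))⁻¹ ≤ (5 / 2 : ℝ)⁻¹ := by gcongr
      _ = 2 / 5 := by norm_num
  have hexp : Real.exp (-x ^ 2 / 2) * (1 + x ^ 2 / 2 + x ^ 4 / 8) ≤ 1 := by
    have h := Real.quadratic_le_exp_of_nonneg (x := x ^ 2 / 2) (by positivity)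
    calc Real.exp (-x ^ 2 / 2) * (1 + x ^ 2 / 2 + x ^ 4 / 8)
        ≤ Real.exp (-x ^ 2 / 2) * Real.exp (x ^ 2 / 2) := by
          gcongr
          linarith
      _ = 1 := by
          rw [← Real.exp_add]
          simp [neg_div]
  unfold stdNormalPDF
  rw [mul_assoc]
  calc _ ≤ (Real.sqrt (2 * Real.pi))⁻¹ * 1 := by gcongr
    _ ≤ 2 / 5 := by linarith

lemma stdNormalPDF_le (x : ℝ) : stdNormalPDF x ≤ 2 / 5 := by
  refine le_trans ?_ (stdNormalPDF_mul_le x)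
  have : 0 ≤ stdNormalPDF x * (x ^ 2 / 2 + x ^ 4 / 8) :=
    mul_nonneg (stdNormalPDF_pos x).le (by positivity)
  linarith

lemma mul_stdNormalPDF_le (x : ℝ) : x * stdNormalPDF x ≤ 2 / 7 := by
  have h := stdNormalPDF_mul_le x
  have h' : 0 ≤ stdNormalPDF x * ((5 / 7) * (1 + x ^ 2 / 2 + x ^ 4 / 8) - x) := by
    apply mul_nonneg (stdNormalPDF_pos x).le
    nlinarith [sq_nonneg (x - 1), sq_nonneg (x ^ 2 - 1)]
  linarith

lemma tendsto_add_inv_mul_stdNormalPDF :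
    Tendsto (fun x => (x + x⁻¹) * stdNormalPDF x) atTop (𝓝 0) := by
  have hlim : Tendsto (fun x : ℝ => 2 * x⁻¹) atTop (𝓝 0) := by
    simpa using tendsto_inv_atTop_zero.const_mul (2 : ℝ)
  refine squeeze_zero' ?_ ?_ hlim
  · filter_upwards [eventually_gt_atTop 0] with x hx
    have := stdNormalPDF_pos x
    positivity
  · filter_upwards [eventually_gt_atTop 0] with x hx
    have hp := stdNormalPDF_pos x
    have h : stdNormalPDF x * (x ^ 2 + 1) ≤ 2 := by
      have := stdNormalPDF_mul_le x
      have : 0 ≤ stdNormalPDF x * x ^ 4 := by positivity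
      nlinarith
    calc (x + x⁻¹) * stdNormalPDF x = (stdNormalPDF x * (x ^ 2 + 1)) * x⁻¹ := by
          field_simp
      _ ≤ 2 * x⁻¹ := by gcongr

lemma hasDerivAt_neg_add_inv_mul_stdNormalPDF {x : ℝ} (hx : x ≠ 0) :
    HasDerivAt (fun x => -((x + x⁻¹) * stdNormalPDF x))
      ((x ^ 2 + (x ^ 2)⁻¹) * stdNormalPDF x) x := by
  refine (((hasDerivAt_id' x).fun_add (hasDerivAt_inv hx)).fun_mul
    (hasDerivAt_stdNormalPDF x)).fun_neg.congr_deriv ?_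
  field_simp
  ring

lemma integrableOn_Ici_sq_mul_stdNormalPDF {t : ℝ} (ht : 0 < t) :
    IntegrableOn (fun x => (x ^ 2 + (x ^ 2)⁻¹) * stdNormalPDF x) (Ici t) := by
  rw [integrableOn_Ici_iff_integrableOn_Ioi]
  refine integrableOn_Ioi_deriv_of_nonneg'
    (fun x hx => hasDerivAt_neg_add_inv_mul_stdNormalPDF (ht.trans_le hx).ne')
    (fun x _ => mul_nonneg (by positivity) (stdNormalPDF_pos x).le)
    (tendsto_add_inv_mul_stdNormalPDF.neg)

lemma integral_Ioi_sq_mul_stdNormalPDF {t : ℝ} (ht : 0 < t) :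
    ∫ x in Ioi t, (x ^ 2 + (x ^ 2)⁻¹) * stdNormalPDF x = (t + t⁻¹) * stdNormalPDF t := by
  rw [integral_Ioi_of_hasDerivAt_of_nonneg'
    (fun x hx => hasDerivAt_neg_add_inv_mul_stdNormalPDF (ht.trans_le hx).ne')
    (fun x _ => mul_nonneg (by positivity) (stdNormalPDF_pos x).le)
    (tendsto_add_inv_mul_stdNormalPDF.neg)]
  simp

lemma rpow_mul_stdNormalPDF_le {q t x : ℝ} (hq2 : q ≤ 2) (ht : 0 < t) (hx : t ≤ x) :
    x ^ q * stdNormalPDF x ≤ t ^ (q - 2) * ((x ^ 2 + (x ^ 2)⁻¹) * stdNormalPDF x) := by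
  have hx0 : 0 < x := ht.trans_le hx
  have h1 : x ^ q = x ^ (q - 2) * x ^ 2 := by
    rw [← Real.rpow_natCast x 2, ← Real.rpow_add hx0]
    norm_num
  have h2 : x ^ (q - 2) ≤ t ^ (q - 2) :=
    Real.rpow_le_rpow_of_nonpos ht hx (by linarith)
  rw [h1, ← mul_assoc]
  have := stdNormalPDF_pos x
  gcongr
  have : 0 ≤ (x ^ 2)⁻¹ := by positivity
  linarith

lemma integrableOn_Ici_rpow_mul_stdNormalPDF {q t : ℝ} (hq2 : q ≤ 2) (ht : 0 < t) :
    IntegrableOn (fun x => x ^ q * stdNormalPDF x) (Ici t) := by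
  refine Integrable.mono' ((integrableOn_Ici_sq_mul_stdNormalPDF ht).const_mul (t ^ (q - 2))) ?_ ?_
  · have := continuous_stdNormalPDF.measurable
    exact Measurable.aestronglyMeasurable (by fun_prop)
  · filter_upwards [ae_restrict_mem measurableSet_Ici] with x hx
    have hx0 : 0 < x := ht.trans_le hx
    have := stdNormalPDF_pos x
    rw [Real.norm_of_nonneg (by positivity)]
    exact rpow_mul_stdNormalPDF_le hq2 ht hx

lemma integral_Ici_rpow_mul_stdNormalPDF_le {q t : ℝ} (hq2 : q ≤ 2) (ht : Real.sqrt 2 ≤ t) :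
    ∫ x in Ici t, x ^ q * stdNormalPDF x ≤ 3 / 2 * (t ^ (q - 1) * stdNormalPDF t) := by
  have ht0 : 0 < t := lt_of_lt_of_le (by positivity) ht
  have ht2 : 2 ≤ t ^ 2 := (Real.sqrt_le_left ht0.le).1 ht
  have hp := stdNormalPDF_pos t
  calc ∫ x in Ici t, x ^ q * stdNormalPDF x
      ≤ ∫ x in Ici t, t ^ (q - 2) * ((x ^ 2 + (x ^ 2)⁻¹) * stdNormalPDF x) :=
        setIntegral_mono_on (integrableOn_Ici_rpow_mul_stdNormalPDF hq2 ht0)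
          ((integrableOn_Ici_sq_mul_stdNormalPDF ht0).const_mul _) measurableSet_Ici
          (fun x hx => rpow_mul_stdNormalPDF_le hq2 ht0 hx)
    _ = t ^ (q - 2) * ((t + t⁻¹) * stdNormalPDF t) := by
        rw [integral_const_mul, integral_Ici_eq_integral_Ioi, integral_Ioi_sq_mul_stdNormalPDF ht0]
    _ ≤ t ^ (q - 2) * (3 / 2 * t * stdNormalPDF t) := by
        gcongr
        have : t⁻¹ ≤ 1 / 2 * t := by
          rw [inv_le_iff_one_le_mul₀ ht0]
          nlinarith
        linarith
    _ = 3 / 2 * (t ^ (q - 1) * stdNormalPDF t) := by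
        have : t ^ (q - 1) = t ^ (q - 2) * t := by
          rw [← Real.rpow_add_one ht0.ne']
          ring_nf
        rw [this]
        ring

lemma integrableOn_Icc_rpow_mul_stdNormalPDF {q a b : ℝ} (hq : 0 ≤ q) :
    IntegrableOn (fun x => x ^ q * stdNormalPDF x) (Icc a b) :=
  ((Real.continuous_rpow_const hq).mul continuous_stdNormalPDF).continuousOn.integrableOn_Icc

lemma integral_gaussianReal_one_eq (μ : ℝ) (f : ℝ → ℝ) :
    ∫ x, f x ∂(gaussianReal μ 1) = ∫ z, stdNormalPDF z * f (z + μ) := by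
  have h := gaussianReal_map_add_const (μ := 0) (v := 1) μ
  rw [zero_add] at h
  rw [← h, (measurableEmbedding_addRight μ).integral_map,
    integral_gaussianReal_eq_integral_smul one_ne_zero]
  simp [stdNormalPDF_eq_gaussianPDFReal]

lemma stdNormalPDF_mul_risk_le {q t μ z : ℝ} (hμ0 : 0 ≤ μ) (hμt : μ < t) :
    stdNormalPDF z * |hardThresh (z + μ) t - μ| ^ q ≤
      μ ^ q * stdNormalPDF z + (Ici t).indicator (fun x => x ^ q * stdNormalPDF x) z
        + (Ici t).indicator (fun x => x ^ q * stdNormalPDF x) (-z)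
        + (Icc (t - μ) t).indicator (fun x => x ^ q * stdNormalPDF x) z := by
  have hp (x : ℝ) := (stdNormalPDF_pos x).le
  have n1 : 0 ≤ μ ^ q * stdNormalPDF z := mul_nonneg (by positivity) (hp z)
  have n2 (x : ℝ) : 0 ≤ (Ici t).indicator (fun x => x ^ q * stdNormalPDF x) x :=
    indicator_nonneg
      (fun y hy => mul_nonneg (Real.rpow_nonneg (by linarith [mem_Ici.1 hy]) _) (hp y)) x
  have n3 : 0 ≤ (Icc (t - μ) t).indicator (fun x => x ^ q * stdNormalPDF x) z :=
    indicator_nonneg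
      (fun y hy => mul_nonneg (Real.rpow_nonneg (by linarith [hy.1]) _) (hp y)) z
  unfold hardThresh
  split_ifs with h
  · rw [add_sub_cancel_right]
    rcases le_abs.1 h with h | h
    · have hz : 0 < z := by linarith
      rw [abs_of_pos hz, mul_comm]
      rcases le_total t z with htz | htz
      · have e := indicator_of_mem (mem_Ici.2 htz) (fun x => x ^ q * stdNormalPDF x)
        linarith [n2 (-z)]
      · have e := indicator_of_mem (show z ∈ Icc (t - μ) t from ⟨by linarith, htz⟩)
          (fun x => x ^ q * stdNormalPDF x)
        linarith [n2 z, n2 (-z)]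
    · have hz : z < 0 := by linarith
      have e := indicator_of_mem (show -z ∈ Ici t from mem_Ici.2 (by linarith))
          (fun x => x ^ q * stdNormalPDF x)
      simp only [stdNormalPDF_neg] at e
      rw [abs_of_neg hz, mul_comm]
      linarith [n2 z]
  · rw [zero_sub, abs_neg, abs_of_nonneg hμ0, mul_comm]
    linarith [n2 z, n2 (-z)]

lemma hardThresh_risk_le_add_integral {q t μ : ℝ} (hq0 : 0 < q) (hq2 : q ≤ 2)
    (ht : Real.sqrt 2 ≤ t) (hμ0 : 0 ≤ μ) (hμt : μ < t) :
    ∫ x, |hardThresh x t - μ| ^ q ∂(gaussianReal μ 1) ≤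
      μ ^ q + 3 * (t ^ (q - 1) * stdNormalPDF t)
        + ∫ x in Icc (t - μ) t, x ^ q * stdNormalPDF x := by
  have ht0 : 0 < t := lt_of_lt_of_le (by positivity) ht
  have i1 := integrable_stdNormalPDF.const_mul (μ ^ q)
  have i2 := (integrableOn_Ici_rpow_mul_stdNormalPDF hq2 ht0).integrable_indicator measurableSet_Ici
  have i4 := (integrableOn_Icc_rpow_mul_stdNormalPDF (a := t - μ) (b := t)
    hq0.le).integrable_indicator measurableSet_Icc
  rw [integral_gaussianReal_one_eq]
  refine (integral_mono_of_nonneg (ae_of_all _ fun z => ?_) (((i1.add i2).add i2.comp_neg).add i4)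
    (ae_of_all _ fun z => stdNormalPDF_mul_risk_le hμ0 hμt)).trans ?_
  · exact mul_nonneg (stdNormalPDF_pos z).le (by positivity)
  · rw [integral_add' ((i1.add i2).add i2.comp_neg) i4, integral_add' (i1.add i2) i2.comp_neg,
      integral_add' i1 i2, integral_neg_eq_self (μ := volume)
        ((Ici t).indicator fun x => x ^ q * stdNormalPDF x),
      integral_indicator measurableSet_Ici, integral_indicator measurableSet_Icc,
      integral_const_mul, integral_stdNormalPDF]
    linarith [integral_Ici_rpow_mul_stdNormalPDF_le hq2 ht]

lemma integral_Icc_rpow_mul_stdNormalPDF_le_of_le_one {q t μ : ℝ} (hq0 : 0 < q) (hq1 : q ≤ 1)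
    (hμ0 : 0 ≤ μ) (hμ1 : μ ≤ 1) (hμt : μ < t) :
    ∫ x in Icc (t - μ) t, x ^ q * stdNormalPDF x ≤ μ ^ q := by
  calc ∫ x in Icc (t - μ) t, x ^ q * stdNormalPDF x
      ≤ ∫ x in Icc (t - μ) t, (1 : ℝ) := by
        refine setIntegral_mono_on (integrableOn_Icc_rpow_mul_stdNormalPDF hq0.le)
          (by simp) measurableSet_Icc fun x hx => ?_
        have hx0 : 0 ≤ x := by linarith [hx.1]
        have hxq : x ^ q ≤ 1 + x := by
          rcases le_total x 1 with h | h
          · linarith [Real.rpow_le_one hx0 h hq0.le]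
          · have := Real.rpow_le_rpow_of_exponent_le h hq1
            rw [Real.rpow_one] at this
            linarith
        have := mul_le_mul_of_nonneg_right hxq (stdNormalPDF_pos x).le
        linarith [stdNormalPDF_le x, mul_stdNormalPDF_le x]
    _ = μ := by simp [hμ0]
    _ ≤ μ ^ q := Real.self_le_rpow_of_le_one hμ0 hμ1 hq1

lemma integral_Icc_rpow_mul_stdNormalPDF_le_sub {q t μ : ℝ} (hq1 : 1 ≤ q)
    (hμ0 : 0 ≤ μ) (hμt : μ < t) :
    ∫ x in Icc (t - μ) t, x ^ q * stdNormalPDF x ≤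
      t ^ (q - 1) * (stdNormalPDF (t - μ) - stdNormalPDF t) := by
  have hc : Continuous fun x => x * stdNormalPDF x := continuous_id.mul continuous_stdNormalPDF
  calc ∫ x in Icc (t - μ) t, x ^ q * stdNormalPDF x
      ≤ ∫ x in Icc (t - μ) t, t ^ (q - 1) * (x * stdNormalPDF x) := by
        refine setIntegral_mono_on (integrableOn_Icc_rpow_mul_stdNormalPDF (by linarith))
          (hc.integrableOn_Icc.const_mul _) measurableSet_Icc fun x hx => ?_
        have hx0 : 0 < x := by linarith [hx.1]
        have h1 : x ^ q = x ^ (q - 1) * x := by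
          rw [← Real.rpow_add_one hx0.ne']
          ring_nf
        have h2 : x ^ (q - 1) ≤ t ^ (q - 1) := Real.rpow_le_rpow hx0.le hx.2 (by linarith)
        have := stdNormalPDF_pos x
        rw [h1, ← mul_assoc]
        gcongr
    _ = t ^ (q - 1) * (stdNormalPDF (t - μ) - stdNormalPDF t) := by
        rw [integral_const_mul, integral_Icc_eq_integral_Ioc,
          ← intervalIntegral.integral_of_le (by linarith),
          intervalIntegral.integral_eq_sub_of_hasDerivAt (f := fun x => -stdNormalPDF x)
            (fun x _ => by simpa using (hasDerivAt_stdNormalPDF x).fun_neg)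
            (hc.intervalIntegrable _ _)]
        ring

lemma mul_stdNormalPDF_sub_le {t μ : ℝ} (hμ0 : 0 < μ) (hμt : μ < t)
    (h : Real.log 2 ≤ t * μ) : t * stdNormalPDF (t - μ) ≤ 3 * μ ^ 2 := by
  obtain ⟨s, rfl⟩ : ∃ s, t = s + μ := ⟨t - μ, by ring⟩
  rw [add_sub_cancel_right]
  have hs : 0 < s := by linarith
  have hp := stdNormalPDF_pos s
  rcases le_total (2 / 5) μ with hμ | hμ
  · have h1 := mul_stdNormalPDF_le s
    have h2 := mul_le_mul_of_nonneg_left (stdNormalPDF_le s) hμ0.le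
    nlinarith
  · have hlog : 2 / 3 ≤ (s + μ) * μ := by linarith [Real.log_two_gt_d9]
    have hcube : (s + μ) ^ 3 * stdNormalPDF s ≤ 4 / 3 := by
      have h1 := stdNormalPDF_mul_le s
      have h2 : (s + μ) ^ 3 ≤ (s + 2 / 5) ^ 3 := by gcongr
      have h3 : (s + 2 / 5) ^ 3 ≤ 10 / 3 * (1 + s ^ 2 / 2 + s ^ 4 / 8) := by
        nlinarith [sq_nonneg (s ^ 2 - 6 / 5 * s - 3 / 2), sq_nonneg (s - 2),
          sq_nonneg (s ^ 2 - 2 * s),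
          sq_nonneg (s ^ 2 - 6 / 5 * s), sq_nonneg (s - 1)]
      have h4 := mul_le_mul_of_nonneg_right (h2.trans h3) hp.le
      linarith
    have hsq : 4 / 9 ≤ (s + μ) ^ 2 * μ ^ 2 := by nlinarith
    have ht2 : 0 < (s + μ) ^ 2 := by positivity
    refine le_of_mul_le_mul_left ?_ ht2
    nlinarith

lemma rpow_mul_stdNormalPDF_sub_le {q t μ : ℝ} (hq2 : q ≤ 2) (hμ0 : 0 ≤ μ) (hμt : μ < t) :
    t ^ (q - 1) * stdNormalPDF (t - μ) ≤ 3 * μ ^ q + 2 * (t ^ (q - 1) * stdNormalPDF t) := by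
  have ht0 : 0 < t := by linarith
  have hp := stdNormalPDF_pos t
  have hp' := stdNormalPDF_pos (t - μ)
  rcases le_total (t * μ) (Real.log 2) with h | h
  · have h1 : stdNormalPDF (t - μ) ≤ 2 * stdNormalPDF t := by
      have : Real.exp (-(t - μ) ^ 2 / 2) ≤ 2 * Real.exp (-t ^ 2 / 2) := by
        rw [← Real.exp_log (show (0 : ℝ) < 2 by norm_num), ← Real.exp_add]
        rw [Real.exp_log (show (0 : ℝ) < 2 by norm_num)]
        gcongr
        nlinarith [sq_nonneg μ]
      unfold stdNormalPDF
      rw [mul_left_comm]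
      gcongr
    have h2 : t ^ (q - 1) * stdNormalPDF (t - μ) ≤ t ^ (q - 1) * (2 * stdNormalPDF t) := by gcongr
    have : 0 ≤ μ ^ q := by positivity
    linarith
  · have hμ : 0 < μ := by
      refine hμ0.lt_of_ne' fun h0 => ?_
      rw [h0, mul_zero] at h
      linarith [Real.log_two_gt_d9]
    have h1 := mul_stdNormalPDF_sub_le hμ hμt h
    have h2 : t ^ (q - 1) ≤ μ ^ (q - 2) * t := by
      have e1 : t ^ (q - 1) = t ^ (q - 2) * t := by
        rw [← Real.rpow_add_one ht0.ne']
        ring_nf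
      have := Real.rpow_le_rpow_of_nonpos hμ hμt.le (show q - 2 ≤ 0 by linarith)
      rw [e1]
      gcongr
    have e2 : μ ^ q = μ ^ (q - 2) * μ ^ 2 := by
      rw [← Real.rpow_natCast μ 2, ← Real.rpow_add hμ]
      norm_num
    have h3 : t ^ (q - 1) * stdNormalPDF (t - μ) ≤ 3 * μ ^ q := by
      calc t ^ (q - 1) * stdNormalPDF (t - μ) ≤ (μ ^ (q - 2) * t) * stdNormalPDF (t - μ) := by
            gcongr
        _ = μ ^ (q - 2) * (t * stdNormalPDF (t - μ)) := by ring
        _ ≤ μ ^ (q - 2) * (3 * μ ^ 2) := by gcongr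
        _ = 3 * μ ^ q := by
          rw [e2]
          ring
    have : 0 ≤ t ^ (q - 1) * stdNormalPDF t := by positivity
    linarith

lemma hardThresh_risk_le_of_one_le {q t μ : ℝ} (hq0 : 0 < q) (hq2 : q ≤ 2) (hμ : 1 ≤ μ) :
    ∫ x, |hardThresh x t - μ| ^ q ∂(gaussianReal μ 1) ≤ 3 * μ ^ q := by
  have hμq : 1 ≤ μ ^ q := Real.one_le_rpow hμ hq0.le
  have i : Integrable (fun x : ℝ => (x - μ) ^ 2) (gaussianReal μ 1) :=
    ((memLp_id_gaussianReal 2).sub (memLp_const μ)).integrable_sq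
  have hvar : ∫ x, (x - μ) ^ 2 ∂(gaussianReal μ 1) = 1 := by
    have := variance_fun_id_gaussianReal (μ := μ) (v := 1)
    rw [variance_eq_integral measurable_id'.aemeasurable, integral_id_gaussianReal] at this
    simpa using this
  calc ∫ x, |hardThresh x t - μ| ^ q ∂(gaussianReal μ 1)
      ≤ ∫ x, ((μ ^ q + 1) + (x - μ) ^ 2) ∂(gaussianReal μ 1) := by
        refine integral_mono_of_nonneg (ae_of_all _ fun x => by positivity)
          ((integrable_const _).add i) (ae_of_all _ fun x => ?_)
        simp only [hardThresh]
        split_ifs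
        · have : |x - μ| ^ q ≤ 1 + (x - μ) ^ 2 := by
            rcases le_total |x - μ| 1 with h | h
            · nlinarith [Real.rpow_le_one (abs_nonneg _) h hq0.le, sq_nonneg (x - μ)]
            · have := Real.rpow_le_rpow_of_exponent_le h hq2
              rw [Real.rpow_two, sq_abs] at this
              linarith
          linarith
        · rw [zero_sub, abs_neg, abs_of_nonneg (by linarith)]
          nlinarith [sq_nonneg (x - μ)]
    _ = μ ^ q + 2 := by
        rw [integral_add (integrable_const _) i, hvar]
        simp
        ring
    _ ≤ 3 * μ ^ q := by linarith

lemma hardThresh_risk_le_of_nonneg {q t μ : ℝ} (hq0 : 0 < q) (hq2 : q ≤ 2)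
    (ht : Real.sqrt 2 ≤ t) (hμ0 : 0 ≤ μ) :
    ∫ x, |hardThresh x t - μ| ^ q ∂(gaussianReal μ 1) ≤
      4 * (μ ^ q + t ^ (q - 1) * stdNormalPDF t) := by
  have ht1 : 1 < t := lt_of_lt_of_le Real.one_lt_sqrt_two ht
  have hμq : 0 ≤ μ ^ q := by positivity
  have hφ : 0 ≤ t ^ (q - 1) * stdNormalPDF t :=
    mul_nonneg (by positivity) (stdNormalPDF_pos t).le
  rcases le_total 1 μ with hμ1 | hμ1
  · linarith [hardThresh_risk_le_of_one_le (t := t) hq0 hq2 hμ1]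
  · have hμt : μ < t := by linarith
    have h := hardThresh_risk_le_add_integral hq0 hq2 ht hμ0 hμt
    rcases le_total q 1 with hq1 | hq1
    · linarith [integral_Icc_rpow_mul_stdNormalPDF_le_of_le_one hq0 hq1 hμ0 hμ1 hμt]
    · linarith [integral_Icc_rpow_mul_stdNormalPDF_le_sub hq1 hμ0 hμt,
        rpow_mul_stdNormalPDF_sub_le hq2 hμ0 hμt]

lemma hardThresh_neg (x t : ℝ) : hardThresh (-x) t = -hardThresh x t := by
  unfold hardThresh
  split_ifs <;> simp_all

lemma hardThresh_risk_neg (q t μ : ℝ) :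
    ∫ x, |hardThresh x t - -μ| ^ q ∂(gaussianReal (-μ) 1) =
      ∫ x, |hardThresh x t - μ| ^ q ∂(gaussianReal μ 1) := by
  rw [← gaussianReal_map_neg]
  refine ((MeasurableEquiv.neg ℝ).measurableEmbedding.integral_map _).trans ?_
  refine integral_congr_ae (ae_of_all _ fun x => ?_)
  simp only [MeasurableEquiv.neg_apply, hardThresh_neg]
  rw [← abs_neg]
  ring_nf

theorem hard_threshold_risk_bound
    (q : ℝ) (hq0 : 0 < q) (hq2 : q ≤ 2) :
    ∃ c : ℝ, 0 < c ∧ c ≤ 4 ∧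
      ∀ t ≥ Real.sqrt 2, ∀ μ : ℝ,
        ∫ x, |hardThresh x t - μ| ^ q ∂(gaussianReal μ 1) ≤
          c * (|μ| ^ q + t ^ (q - 1) * stdNormalPDF t) := by
  refine ⟨4, by norm_num, le_rfl, fun t ht μ => ?_⟩
  rcases le_total 0 μ with h | h
  · rw [abs_of_nonneg h]
    exact hardThresh_risk_le_of_nonneg hq0 hq2 ht h
  · rw [abs_of_nonpos h, ← hardThresh_risk_neg]
    exact hardThresh_risk_le_of_nonneg hq0 hq2 ht (neg_nonneg.2 h)
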